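/- Let Ω ⊂ ℝ³ be a bounded open set. Then there exists a constant C > 0, depending only on Ω, such that for every sequence of weights λ_k ≥ 0 and all sequences {ψ_k}_{k∈ℕ} and {φ_k}_{k∈ℕ} of smooth compactly supported functions ℝ³ → ℂ with supports contained in Ω, the densities n[Ψ] := Σ_k λ_k |ψ_k|² and n[Φ] := Σ_k λ_k |φ_k|² satisfy ‖n[Ψ] − n[Φ]‖_{L²(ℝ³)} ≤ C ( (Σ_k λ_k ‖∇ψ_k‖²_{L²})^{1/2} + (Σ_k λ_k ‖∇φ_k‖²_{L²})^{1/2} ) (Σ_k λ_k ‖∇(ψ_k − φ_k)‖²_{L²})^{1/2}. -/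

import Mathlib

open MeasureTheory
open scoped ENNReal

/-- Minkowski's inequality in `L²` for countable sums of `[0,∞]`-valued functions. -/
lemma lintegral_tsum_sq_rpow_half_le {α ι : Type*} [Countable ι] [MeasurableSpace α]
    {μ : Measure α} {f : ι → α → ℝ≥0∞} (hf : ∀ k, AEMeasurable (f k) μ) :
    (∫⁻ x, (∑' k, f k x) ^ 2 ∂μ) ^ (1 / 2 : ℝ) ≤
      ∑' k, (∫⁻ x, f k x ^ 2 ∂μ) ^ (1 / 2 : ℝ) := by
  rw [one_div, ENNReal.rpow_inv_le_iff (by norm_num), ENNReal.rpow_ofNat]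
  calc ∫⁻ x, (∑' k, f k x) ^ 2 ∂μ
      = ∑' j, ∑' k, ∫⁻ x, f j x * f k x ∂μ := by
        simp_rw [sq, ← ENNReal.tsum_mul_right]
        rw [lintegral_tsum fun j ↦ by exact (hf j).mul (AEMeasurable.tsum hf)]
        refine tsum_congr fun j ↦ ?_
        simp_rw [← ENNReal.tsum_mul_left]
        exact lintegral_tsum fun k ↦ (hf j).mul (hf k)
    _ ≤ ∑' j, ∑' k, (∫⁻ x, f j x ^ 2 ∂μ) ^ (2⁻¹ : ℝ) * (∫⁻ x, f k x ^ 2 ∂μ) ^ (2⁻¹ : ℝ) := by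
        refine ENNReal.tsum_le_tsum fun j ↦ ENNReal.tsum_le_tsum fun k ↦ ?_
        simpa using ENNReal.lintegral_mul_le_Lp_mul_Lq μ Real.HolderConjugate.two_two
          (hf j) (hf k)
    _ = (∑' k, (∫⁻ x, f k x ^ 2 ∂μ) ^ (2⁻¹ : ℝ)) ^ 2 := by
        simp_rw [ENNReal.tsum_mul_left, ENNReal.tsum_mul_right, sq]

/-- The Cauchy–Schwarz inequality for sums in `[0,∞]`. -/
lemma ENNReal.tsum_mul_le_rpow_half_mul_rpow_half {ι : Type*} (a b : ι → ℝ≥0∞) :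
    ∑' k, a k * b k ≤ (∑' k, a k ^ 2) ^ (1 / 2 : ℝ) * (∑' k, b k ^ 2) ^ (1 / 2 : ℝ) := by
  let _ : MeasurableSpace ι := ⊤
  simpa [lintegral_count] using ENNReal.lintegral_mul_le_Lp_mul_Lq Measure.count
    Real.HolderConjugate.two_two (measurable_from_top (f := a)).aemeasurable
    (measurable_from_top (f := b)).aemeasurable

/-- The pointwise difference of two sums of squares is controlled by the differences `d k`. -/
lemma ENNReal.tsum_sq_sub_tsum_sq_le {ι : Type*} {a b d : ι → ℝ≥0∞}
    (h : ∀ k, a k ≤ b k + d k) :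
    (∑' k, a k ^ 2) - ∑' k, b k ^ 2 ≤ ∑' k, (a k + b k) * d k := by
  rw [tsub_le_iff_left, ← ENNReal.tsum_add]
  refine ENNReal.tsum_le_tsum fun k ↦ ?_
  calc a k ^ 2 = a k * a k := sq _
    _ ≤ a k * (b k + d k) := by gcongr; exact h k
    _ = b k * a k + a k * d k := by ring
    _ ≤ b k * (b k + d k) + a k * d k := by gcongr; exact h k
    _ = b k ^ 2 + (a k + b k) * d k := by ring

lemma ENNReal.ofReal_mul_norm_sq {F : Type*} [NormedAddCommGroup F] {l : ℝ} (hl : 0 ≤ l)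
    (v : F) : ENNReal.ofReal (l * ‖v‖ ^ 2) = (ENNReal.ofReal √l * ‖v‖ₑ) ^ 2 := by
  rw [← ofReal_norm, ← ENNReal.ofReal_mul (by positivity),
    ← ENNReal.ofReal_pow (by positivity), mul_pow, Real.sq_sqrt hl]

lemma ofReal_mul_integral_norm_sq {α F : Type*} [MeasurableSpace α] {μ : Measure α}
    [NormedAddCommGroup F] {g : α → F} {l : ℝ} (hl : 0 ≤ l) (hg : MemLp g 2 μ) :
    ENNReal.ofReal (l * ∫ x, ‖g x‖ ^ 2 ∂μ) = (ENNReal.ofReal √l * eLpNorm g 2 μ) ^ 2 := by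
  have hint : Integrable (fun x ↦ ‖g x‖ ^ 2) μ := hg.integrable_norm_pow two_ne_zero
  rw [ENNReal.ofReal_mul hl, mul_pow, ← ENNReal.ofReal_pow (by positivity), Real.sq_sqrt hl,
    ofReal_integral_eq_lintegral_ofReal hint (.of_forall fun _ ↦ by positivity),
    eLpNorm_eq_lintegral_rpow_enorm_toReal two_ne_zero (by simp), ← ENNReal.rpow_natCast,
    ← ENNReal.rpow_mul]
  simp [ENNReal.ofReal_pow]

/-- Hölder's inequality `L⁴ · L⁴ ⊆ L²` for `(‖u‖ + ‖v‖) ‖w‖`. -/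
lemma lintegral_enorm_add_mul_sq_rpow_half_le {α F : Type*} [MeasurableSpace α] {μ : Measure α}
    [NormedAddCommGroup F] {u v w : α → F} (hu : AEStronglyMeasurable u μ)
    (hv : AEStronglyMeasurable v μ) (hw : AEStronglyMeasurable w μ) :
    (∫⁻ x, ((‖u x‖ₑ + ‖v x‖ₑ) * ‖w x‖ₑ) ^ 2 ∂μ) ^ (1 / 2 : ℝ) ≤
      (eLpNorm u 4 μ + eLpNorm v 4 μ) * eLpNorm w 4 μ := by
  have hr (a b : F) : ‖‖a‖ + ‖b‖‖ₑ = ‖a‖ₑ + ‖b‖ₑ := by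
    rw [Real.enorm_eq_ofReal (by positivity), ENNReal.ofReal_add (by positivity) (by positivity),
      ofReal_norm, ofReal_norm]
  have : ENNReal.HolderTriple 4 4 2 := ⟨by
    rw [← two_mul, show (4 : ℝ≥0∞) = 2 * 2 by norm_num, ENNReal.mul_inv (by simp) (by simp),
      ← mul_assoc, ENNReal.mul_inv_cancel (by simp) (by simp), one_mul]⟩
  calc (∫⁻ x, ((‖u x‖ₑ + ‖v x‖ₑ) * ‖w x‖ₑ) ^ 2 ∂μ) ^ (1 / 2 : ℝ)
      = eLpNorm (fun x ↦ (‖u x‖ + ‖v x‖) * ‖w x‖) 2 μ := by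
        rw [eLpNorm_eq_lintegral_rpow_enorm_toReal two_ne_zero (by simp)]
        simp [enorm_mul, hr]
    _ ≤ eLpNorm (fun x ↦ ‖u x‖ + ‖v x‖) 4 μ * eLpNorm (fun x ↦ ‖w x‖) 4 μ :=
        eLpNorm_smul_le_mul_eLpNorm (𝕜 := ℝ) (f := fun x ↦ ‖w x‖)
          (φ := fun x ↦ ‖u x‖ + ‖v x‖) hw.norm (hu.norm.add hv.norm)
    _ ≤ (eLpNorm (fun x ↦ ‖u x‖) 4 μ + eLpNorm (fun x ↦ ‖v x‖) 4 μ) *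
          eLpNorm (fun x ↦ ‖w x‖) 4 μ := by
        gcongr
        exact eLpNorm_add_le hu.norm hv.norm (by norm_num)
    _ = _ := by simp only [eLpNorm_norm]

lemma ContDiff.memLp_fderiv_of_hasCompactSupport {E F : Type*} [NormedAddCommGroup E]
    [NormedSpace ℝ E] [FiniteDimensional ℝ E] [MeasurableSpace E] [BorelSpace E]
    [NormedAddCommGroup F] [NormedSpace ℝ F] {μ : Measure E} [IsFiniteMeasureOnCompacts μ]
    {u : E → F} (hu : ContDiff ℝ 1 u) (hc : HasCompactSupport u) (p : ℝ≥0∞) :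
    MemLp (fderiv ℝ u) p μ :=
  (hu.continuous_fderiv one_ne_zero).memLp_of_hasCompactSupport (hc.fderiv ℝ)

/-- The Sobolev inequality `‖u‖_{L⁴} ≤ C ‖∇u‖_{L²}` on a bounded subset of `ℝ³`. -/
lemma exists_eLpNorm_four_le_eLpNorm_fderiv_two {s : Set (EuclideanSpace ℝ (Fin 3))}
    (hs : Bornology.IsBounded s) :
    ∃ C : NNReal, ∀ u : EuclideanSpace ℝ (Fin 3) → ℂ, ContDiff ℝ 1 u → tsupport u ⊆ s →
      eLpNorm u 4 volume ≤ C * eLpNorm (fderiv ℝ u) 2 volume := by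
  refine ⟨eLpNormLESNormFDerivOfLeConst ℂ volume s 2 4, fun u hu hus ↦ ?_⟩
  exact_mod_cast eLpNorm_le_eLpNorm_fderiv_of_le (p := 2) (q := 4) volume hu
    ((subset_tsupport u).trans hus) (by norm_num) (by simp; norm_num) (by simp; norm_num) hs

/-- **Lipschitz estimate for the density (Lemma 5).** For a bounded open set `Ω ⊂ ℝ³`
there is `C > 0` such that for all nonnegative weights `λ_k` and all smooth functions
`ψ_k`, `φ_k` compactly supported in `Ω`, the densities `n[Ψ] = Σ λ_k |ψ_k|²` and
`n[Φ] = Σ λ_k |φ_k|²` satisfy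
`‖n[Ψ] − n[Φ]‖_{L²} ≤ C (‖Ψ‖_{Ḣ¹_λ} + ‖Φ‖_{Ḣ¹_λ}) ‖Ψ − Φ‖_{Ḣ¹_λ}`,
both sides possibly infinite.  (The pointwise absolute difference of the
`[0,∞]`-valued densities `a`, `b` is expressed as `(a - b) ⊔ (b - a)` using
truncated subtraction.) -/
theorem density_difference_L2_bound_by_weighted_H1
    (Ω : Set (EuclideanSpace ℝ (Fin 3))) (hΩo : IsOpen Ω) (hΩb : Bornology.IsBounded Ω) :
    ∃ C : ℝ, 0 < C ∧
      ∀ (l : ℕ → ℝ) (_ : ∀ k, 0 ≤ l k)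
        (ψ φ : ℕ → EuclideanSpace ℝ (Fin 3) → ℂ)
        (_ : ∀ k, ContDiff ℝ (⊤ : ℕ∞) (ψ k)) (_ : ∀ k, HasCompactSupport (ψ k))
        (_ : ∀ k, tsupport (ψ k) ⊆ Ω)
        (_ : ∀ k, ContDiff ℝ (⊤ : ℕ∞) (φ k)) (_ : ∀ k, HasCompactSupport (φ k))
        (_ : ∀ k, tsupport (φ k) ⊆ Ω),
        (∫⁻ x,
            (((∑' k, ENNReal.ofReal (l k * ‖ψ k x‖ ^ 2)) -
                  ∑' k, ENNReal.ofReal (l k * ‖φ k x‖ ^ 2)) ⊔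
                ((∑' k, ENNReal.ofReal (l k * ‖φ k x‖ ^ 2)) -
                  ∑' k, ENNReal.ofReal (l k * ‖ψ k x‖ ^ 2))) ^ 2) ^ (1 / 2 : ℝ) ≤
          ENNReal.ofReal C *
            ((∑' k, ENNReal.ofReal (l k * ∫ x, ‖fderiv ℝ (ψ k) x‖ ^ 2)) ^ (1 / 2 : ℝ) +
              (∑' k, ENNReal.ofReal (l k * ∫ x, ‖fderiv ℝ (φ k) x‖ ^ 2)) ^ (1 / 2 : ℝ)) *
            (∑' k, ENNReal.ofReal
                (l k * ∫ x, ‖fderiv ℝ (fun y => ψ k y - φ k y) x‖ ^ 2)) ^ (1 / 2 : ℝ) := by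
  obtain ⟨K, hK⟩ := exists_eLpNorm_four_le_eLpNorm_fderiv_two hΩb
  refine ⟨K ^ 2 + 1, by positivity, fun l hl ψ φ hψ hψc hψs hφ hφc hφs ↦ ?_⟩
  have hψ1 k : ContDiff ℝ 1 (ψ k) := (hψ k).of_le (by norm_cast)
  have hφ1 k : ContDiff ℝ 1 (φ k) := (hφ k).of_le (by norm_cast)
  have hχ1 k : ContDiff ℝ 1 (fun y ↦ ψ k y - φ k y) := (hψ1 k).sub (hφ1 k)
  have hχc k : HasCompactSupport (fun y ↦ ψ k y - φ k y) := (hψc k).sub (hφc k)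
  have hχs k : tsupport (fun y ↦ ψ k y - φ k y) ⊆ Ω :=
    (tsupport_sub (ψ k) (φ k)).trans (Set.union_subset (hψs k) (hφs k))
  simp_rw [ENNReal.ofReal_mul_norm_sq (hl _),
    ofReal_mul_integral_norm_sq (hl _) ((hψ1 _).memLp_fderiv_of_hasCompactSupport (hψc _) 2),
    ofReal_mul_integral_norm_sq (hl _) ((hφ1 _).memLp_fderiv_of_hasCompactSupport (hφc _) 2),
    ofReal_mul_integral_norm_sq (hl _) ((hχ1 _).memLp_fderiv_of_hasCompactSupport (hχc _) 2)]
  set r : ℕ → ℝ≥0∞ := fun k ↦ ENNReal.ofReal √(l k)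
  set a : ℕ → ℝ≥0∞ := fun k ↦ r k * eLpNorm (fderiv ℝ (ψ k)) 2 volume
  set b : ℕ → ℝ≥0∞ := fun k ↦ r k * eLpNorm (fderiv ℝ (φ k)) 2 volume
  set d : ℕ → ℝ≥0∞ := fun k ↦ r k * eLpNorm (fderiv ℝ (fun y ↦ ψ k y - φ k y)) 2 volume
  let f : ℕ → EuclideanSpace ℝ (Fin 3) → ℝ≥0∞ := fun k x ↦
    r k ^ 2 * ((‖ψ k x‖ₑ + ‖φ k x‖ₑ) * ‖ψ k x - φ k x‖ₑ)
  have hf k : Measurable (f k) := by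
    have h1 := (hψ1 k).continuous
    have h2 := (hφ1 k).continuous
    exact measurable_const.mul (((h1.enorm.measurable).add h2.enorm.measurable).mul
      (h1.sub h2).enorm.measurable)
  have hpt x : ((∑' k, (r k * ‖ψ k x‖ₑ) ^ 2) - ∑' k, (r k * ‖φ k x‖ₑ) ^ 2) ⊔
      ((∑' k, (r k * ‖φ k x‖ₑ) ^ 2) - ∑' k, (r k * ‖ψ k x‖ₑ) ^ 2) ≤ ∑' k, f k x := by
    refine sup_le ?_ ?_
    · refine (ENNReal.tsum_sq_sub_tsum_sq_le (d := fun k ↦ r k * ‖ψ k x - φ k x‖ₑ)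
        fun k ↦ ?_).trans_eq (tsum_congr fun k ↦ by simp only [f]; ring)
      rw [← mul_add]
      gcongr
      simpa using enorm_add_le (φ k x) (ψ k x - φ k x)
    · refine (ENNReal.tsum_sq_sub_tsum_sq_le (d := fun k ↦ r k * ‖ψ k x - φ k x‖ₑ)
        fun k ↦ ?_).trans_eq (tsum_congr fun k ↦ by simp only [f]; ring)
      rw [← mul_add, enorm_sub_rev]
      gcongr
      simpa using enorm_add_le (ψ k x) (φ k x - ψ k x)
  have hfk k : (∫⁻ x, f k x ^ 2) ^ (1 / 2 : ℝ) ≤ (K : ℝ≥0∞) ^ 2 * ((a k + b k) * d k) := by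
    have h1 := (hψ1 k).continuous.aestronglyMeasurable (μ := volume)
    have h2 := (hφ1 k).continuous.aestronglyMeasurable (μ := volume)
    have h3 := (hχ1 k).continuous.aestronglyMeasurable (μ := volume)
    calc (∫⁻ x, f k x ^ 2) ^ (1 / 2 : ℝ)
        = r k ^ 2 * (∫⁻ x, ((‖ψ k x‖ₑ + ‖φ k x‖ₑ) * ‖ψ k x - φ k x‖ₑ) ^ 2) ^ (1 / 2 : ℝ) := by
          simp only [f, mul_pow (r k ^ 2)]
          rw [lintegral_const_mul' _ _ (by simp [r]), ENNReal.mul_rpow_of_nonneg _ _ (by norm_num),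
            ← ENNReal.rpow_natCast (r k ^ 2), ← ENNReal.rpow_mul]
          norm_num
      _ ≤ r k ^ 2 * ((K * eLpNorm (fderiv ℝ (ψ k)) 2 volume +
            K * eLpNorm (fderiv ℝ (φ k)) 2 volume) *
            (K * eLpNorm (fderiv ℝ (fun y ↦ ψ k y - φ k y)) 2 volume)) := by
          gcongr
          refine (lintegral_enorm_add_mul_sq_rpow_half_le h1 h2 h3).trans ?_
          gcongr
          · exact hK _ (hψ1 k) (hψs k)
          · exact hK _ (hφ1 k) (hφs k)
          · exact hK _ (hχ1 k) (hχs k)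
      _ = (K : ℝ≥0∞) ^ 2 * ((a k + b k) * d k) := by simp only [a, b, d]; ring
  have hKC : (K : ℝ≥0∞) ^ 2 ≤ ENNReal.ofReal ((K : ℝ) ^ 2 + 1) := by
    rw [← ENNReal.ofReal_coe_nnreal, ← ENNReal.ofReal_pow (by positivity)]
    exact ENNReal.ofReal_le_ofReal (by linarith)
  calc _ ≤ (∫⁻ x, (∑' k, f k x) ^ 2) ^ (1 / 2 : ℝ) := by
        gcongr with x
        exact hpt x
    _ ≤ ∑' k, (∫⁻ x, f k x ^ 2) ^ (1 / 2 : ℝ) :=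
        lintegral_tsum_sq_rpow_half_le fun k ↦ (hf k).aemeasurable
    _ ≤ ∑' k, (K : ℝ≥0∞) ^ 2 * ((a k + b k) * d k) := ENNReal.tsum_le_tsum hfk
    _ = (K : ℝ≥0∞) ^ 2 * (∑' k, a k * d k + ∑' k, b k * d k) := by
        simp_rw [ENNReal.tsum_mul_left, add_mul, ENNReal.tsum_add]
    _ ≤ ENNReal.ofReal ((K : ℝ) ^ 2 + 1) *
          ((∑' k, a k ^ 2) ^ (1 / 2 : ℝ) * (∑' k, d k ^ 2) ^ (1 / 2 : ℝ) +
            (∑' k, b k ^ 2) ^ (1 / 2 : ℝ) * (∑' k, d k ^ 2) ^ (1 / 2 : ℝ)) := by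
        gcongr
        · exact ENNReal.tsum_mul_le_rpow_half_mul_rpow_half a d
        · exact ENNReal.tsum_mul_le_rpow_half_mul_rpow_half b d
    _ = _ := by rw [← add_mul, mul_assoc]
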